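/- Let D ⊆ ℂ × ℂ be a nonempty open set, let D₁ := Prod.fst '' D and D₂ := Prod.snd '' D, and for an index type S let (g_s : D₁ → ℂ) and (h_s : D₂ → ℂ) be families of holomorphic functions; define F_s : D → ℂ × ℂ by F_s(w₁, w₂) = (g_s(w₁), h_s(w₂)). If the family {g_s} is normal on D₁ and the family {h_s} is normal on D₂, then the family {F_s} is normal on D. -/

import Mathlib

/-- A family `F : ι → α → β` of functions is normal on a set `U` if every sequence in the
family has a subsequence converging uniformly on every compact subset of `U` to some limit
function. -/
def NormalOn {α β ι : Type*} [TopologicalSpace α] [UniformSpace β]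
    (F : ι → α → β) (U : Set α) : Prop :=
  ∀ u : ℕ → ι, ∃ φ : ℕ → ℕ, StrictMono φ ∧ ∃ f : α → β,
    ∀ K : Set α, K ⊆ U → IsCompact K →
      TendstoUniformlyOn (fun n => F (u (φ n))) f Filter.atTop K

/-- If both component families of a family of split-form bicomplex holomorphic functions are
normal on the coordinate projections `D₁ = Prod.fst '' D`, `D₂ = Prod.snd '' D` of a
bicomplex domain `D`, then the bicomplex family is normal on `D`. -/
theorem stmt7 {S : Type*} (D : Set (ℂ × ℂ)) (hD : IsOpen D) (hne : D.Nonempty)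
    (g h : S → ℂ → ℂ)
    (hg : ∀ s, DifferentiableOn ℂ (g s) (Prod.fst '' D))
    (hh : ∀ s, DifferentiableOn ℂ (h s) (Prod.snd '' D))
    (hng : NormalOn g (Prod.fst '' D)) (hnh : NormalOn h (Prod.snd '' D)) :
    NormalOn (fun s => fun w : ℂ × ℂ => (g s w.1, h s w.2)) D := by
  intro u
  obtain ⟨φ, hφ, f, hf⟩ := hng u
  obtain ⟨ψ, hψ, k, hk⟩ := hnh (fun n => u (φ n))
  refine ⟨fun n => φ (ψ n), hφ.comp hψ, fun w => (f w.1, k w.2), ?_⟩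
  intro K hKD hK
  have h1 := hf _ (Set.image_mono hKD) (hK.image continuous_fst)
  have h2 := hk _ (Set.image_mono hKD) (hK.image continuous_snd)
  rw [Metric.tendstoUniformlyOn_iff] at h1 h2 ⊢
  intro ε hε
  filter_upwards [hψ.tendsto_atTop.eventually (h1 ε hε), h2 ε hε] with n a b w hw
  rw [Prod.dist_eq]
  exact max_lt (a w.1 (Set.mem_image_of_mem _ hw)) (b w.2 (Set.mem_image_of_mem _ hw))
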